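/- arXiv:2601.02796 — 8 statements merged into one kernel-verified Lean document; each statement's English description precedes it below -/
import Mathlib

section
/- Let Y ⊆ ℝ^K be a nonempty set, let A be a real p×K matrix of rank K (equivalently, the linear map x ↦ Ax is injective), and let C = {y ∈ ℝ^K : Ay ≥ 0 componentwise}. Then A · N(Y, C) = N(A · Y, P), where A · S denotes the image of a set S under the linear map A and P = {z ∈ ℝ^p : z_i ≥ 0 for all i} is the Pareto cone; that is, the image under A of the C-non-dominated points of Y equals the Pareto-non-dominated points of the image A · Y. -/
/-- The `C`-non-dominated set of `Y ⊆ ℝ^n`: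
`N(Y, C) = {y ∈ Y : (y − C) ∩ Y = {y}}`. -/
def ndom {n : ℕ} (Y C : Set (Fin n → ℝ)) : Set (Fin n → ℝ) :=
  {y | y ∈ Y ∧ {z | z ∈ Y ∧ y - z ∈ C} = {y}}

/-- Let `Y ⊆ ℝ^K` be nonempty, `A` a real `p×K` matrix of rank `K` (i.e. `x ↦ Ax` is
injective), and `C = {y : Ay ≥ 0}`.  Then `A · N(Y, C) = N(A · Y, P)`, where `P` is the
Pareto cone (nonnegative orthant) in `ℝ^p`. -/
theorem image_ndom_eq_ndom_image {K p : ℕ} (Y : Set (Fin K → ℝ)) (hY : Y.Nonempty)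
    (A : Matrix (Fin p) (Fin K) ℝ) (hA : Function.Injective A.mulVec) :
    A.mulVec '' ndom Y {y | ∀ i, 0 ≤ A.mulVec y i}
      = ndom (A.mulVec '' Y) {z | ∀ i, 0 ≤ z i} := by
  have key : ∀ y, {w | w ∈ A.mulVec '' Y ∧ A.mulVec y - w ∈ {z | ∀ i, 0 ≤ z i}}
      = A.mulVec '' {z | z ∈ Y ∧ y - z ∈ {y | ∀ i, 0 ≤ A.mulVec y i}} := by
    intro y
    ext w
    constructor
    · rintro ⟨⟨z, hz, rfl⟩, h⟩
      exact ⟨z, ⟨hz, by simpa [Matrix.mulVec_sub] using h⟩, rfl⟩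
    · rintro ⟨z, ⟨hz, h⟩, rfl⟩
      exact ⟨⟨z, hz, rfl⟩, by simpa [Matrix.mulVec_sub] using h⟩
  ext w
  constructor
  · rintro ⟨y, ⟨hy, h⟩, rfl⟩
    exact ⟨⟨y, hy, rfl⟩, by rw [key y, h, Set.image_singleton]⟩
  · rintro ⟨⟨y, hy, rfl⟩, h⟩
    rw [key y, ← Set.image_singleton] at h
    exact ⟨y, ⟨hy, hA.image_injective h⟩, rfl⟩
end

section
/- Let ω, γ ∈ ℝ^{K−1} have nonnegative components and satisfy ω_i γ_i < 1 for all i = 1,…,K−1. Then the set {y ∈ ℝ^K : ν·y ≥ 0 for all ν ∈ V} equals the finitely generated cone of the 2(K−1) vectors u^1,…,u^{K−1}, g^1,…,g^{K−1}, i.e. it equals {Σ_{i=1}^{K−1} (α_i u^i + β_i g^i) : α_i ≥ 0, β_i ≥ 0 for all i}. -/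
/- Throughout, the number of ordered categories is `K + 1` (so `K + 1 ≥ 2` when `1 ≤ K`),
vectors live in `ℝ^(K+1)` and the weight vectors `ω, γ` live in `ℝ^K`.
For `i : Fin K`, the paper's index `i` corresponds to `i.castSucc` and `i+1` to `i.succ`. -/

/-- The set `V` of `(ω,γ)`-numerical representations. -/
def numRep {K : ℕ} (ω γ : Fin K → ℝ) : Set (Fin (K + 1) → ℝ) :=
  {ν | (∀ k, 0 ≤ ν k) ∧
    ∀ i : Fin K, ω i * ν i.castSucc ≤ ν i.succ ∧ γ i * ν i.succ ≤ ν i.castSucc}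

/-- `u^i = e_{i+1} − ω_i e_i`. -/
def uvec {K : ℕ} (ω : Fin K → ℝ) (i : Fin K) : Fin (K + 1) → ℝ :=
  (Pi.single i.succ 1 : Fin (K + 1) → ℝ) - ω i • (Pi.single i.castSucc 1 : Fin (K + 1) → ℝ)

/-- `g^i = e_i − γ_i e_{i+1}`. -/
def gvec {K : ℕ} (γ : Fin K → ℝ) (i : Fin K) : Fin (K + 1) → ℝ :=
  (Pi.single i.castSucc 1 : Fin (K + 1) → ℝ) - γ i • (Pi.single i.succ 1 : Fin (K + 1) → ℝ)

lemma dotProduct_uvec {K : ℕ} (ω : Fin K → ℝ) (ν : Fin (K + 1) → ℝ) (i : Fin K) :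
    ν ⬝ᵥ uvec ω i = ν i.succ - ω i * ν i.castSucc := by
  simp [uvec, dotProduct_sub, dotProduct_smul]

lemma dotProduct_gvec {K : ℕ} (γ : Fin K → ℝ) (ν : Fin (K + 1) → ℝ) (i : Fin K) :
    ν ⬝ᵥ gvec γ i = ν i.castSucc - γ i * ν i.succ := by
  simp [gvec, dotProduct_sub, dotProduct_smul]

lemma uvec_castSucc_castSucc {K : ℕ} (ω : Fin (K + 1) → ℝ) (i : Fin K) (k : Fin (K + 1)) :
    uvec ω i.castSucc k.castSucc = uvec (fun j => ω j.castSucc) i k := by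
  simp [uvec, Pi.single_apply, Fin.ext_iff]

lemma gvec_castSucc_castSucc {K : ℕ} (γ : Fin (K + 1) → ℝ) (i : Fin K) (k : Fin (K + 1)) :
    gvec γ i.castSucc k.castSucc = gvec (fun j => γ j.castSucc) i k := by
  simp [gvec, Pi.single_apply, Fin.ext_iff]

lemma uvec_castSucc_last {K : ℕ} (ω : Fin (K + 1) → ℝ) (i : Fin K) :
    uvec ω i.castSucc (Fin.last (K + 1)) = 0 := by
  have h : K ≠ i := i.isLt.ne'
  have h' : K + 1 ≠ i := by lia
  simp [uvec, Fin.ext_iff, h, h']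

lemma gvec_castSucc_last {K : ℕ} (γ : Fin (K + 1) → ℝ) (i : Fin K) :
    gvec γ i.castSucc (Fin.last (K + 1)) = 0 := by
  have h : K ≠ i := i.isLt.ne'
  have h' : K + 1 ≠ i := by lia
  simp [gvec, Fin.ext_iff, h, h']

lemma snoc_mem_numRep {K : ℕ} {ω γ : Fin (K + 1) → ℝ} {ν : Fin (K + 1) → ℝ} {t : ℝ}
    (hν : ν ∈ numRep (fun j => ω j.castSucc) (fun j => γ j.castSucc)) (ht : 0 ≤ t)
    (hωt : ω (Fin.last K) * ν (Fin.last K) ≤ t) (hγt : γ (Fin.last K) * t ≤ ν (Fin.last K)) :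
    (Fin.snoc ν t : Fin (K + 2) → ℝ) ∈ numRep ω γ := by
  refine ⟨fun k => ?_, fun i => ?_⟩
  · induction k using Fin.lastCases with
    | last => simpa using ht
    | cast k => simpa using hν.1 k
  · induction i using Fin.lastCases with
    | last => simpa using And.intro hωt hγt
    | cast i => simpa only [Fin.succ_castSucc, Fin.snoc_castSucc] using hν.2 i

/-- If the last coordinate of `y` is that of `a u + b g` for the last generators `u` and `g`, then
`y` lies in the cone as soon as the remaining coordinates of `y - (a u + b g)` lie in the cone in
one dimension less. -/
lemma exists_cone_of_peel {K : ℕ} {ω γ : Fin (K + 1) → ℝ} {y : Fin (K + 2) → ℝ} {a b : ℝ}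
    (ha : 0 ≤ a) (hb : 0 ≤ b)
    (hy : y (Fin.last (K + 1)) = a - γ (Fin.last K) * b)
    (h : ∃ r : ℝ, ∃ α β : Fin K → ℝ, 0 ≤ r ∧ (∀ i, 0 ≤ α i) ∧ (∀ i, 0 ≤ β i) ∧
      (fun k => y k.castSucc) - Pi.single (Fin.last K) (b - ω (Fin.last K) * a) =
        Pi.single 0 r + ∑ i, (α i • uvec (fun j => ω j.castSucc) i +
          β i • gvec (fun j => γ j.castSucc) i)) :
    ∃ r : ℝ, ∃ α β : Fin (K + 1) → ℝ, 0 ≤ r ∧ (∀ i, 0 ≤ α i) ∧ (∀ i, 0 ≤ β i) ∧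
      y = Pi.single 0 r + ∑ i, (α i • uvec ω i + β i • gvec γ i) := by
  obtain ⟨r, α, β, hr, hα, hβ, h⟩ := h
  refine ⟨r, Fin.snoc α a, Fin.snoc β b, hr, fun i => ?_, fun i => ?_, ?_⟩
  · induction i using Fin.lastCases with
    | last => simpa using ha
    | cast i => simpa using hα i
  · induction i using Fin.lastCases with
    | last => simpa using hb
    | cast i => simpa using hβ i
  · ext k
    rw [Fin.sum_univ_castSucc]
    induction k using Fin.lastCases with
    | last =>
      simp only [hy, Pi.add_apply, Finset.sum_apply, Pi.smul_apply, uvec_castSucc_last,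
        gvec_castSucc_last, Fin.snoc_last]
      simp [uvec, gvec, (Fin.castSucc_lt_last _).ne']
      ring
    | cast k =>
      have hk := congrFun h k
      simp only [Pi.sub_apply, Pi.add_apply, Finset.sum_apply, Pi.smul_apply] at hk
      simp only [Pi.add_apply, Finset.sum_apply, Pi.smul_apply, Fin.snoc_castSucc,
        uvec_castSucc_castSucc, gvec_castSucc_castSucc, Fin.snoc_last]
      rw [sub_eq_iff_eq_add] at hk
      rw [hk]
      by_cases hkl : k = Fin.last K
      · subst hkl
        simp [uvec, gvec, Pi.single_apply, Fin.ext_iff]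
        ring
      · simp [uvec, gvec, hkl, (Fin.castSucc_lt_last k).ne, Pi.single_apply]

/-- The dual of `V` lies in the cone of the vectors `e_1`, `u^i`, `g^i`; unlike the version
without `e_1`, this also holds in dimension one. -/
lemma exists_cone_of_mem_dual {K : ℕ} (ω γ : Fin K → ℝ) (hω : ∀ i, 0 ≤ ω i) (hγ : ∀ i, 0 ≤ γ i)
    (h1 : ∀ i, ω i * γ i < 1) (y : Fin (K + 1) → ℝ) (hy : ∀ ν ∈ numRep ω γ, 0 ≤ ν ⬝ᵥ y) :
    ∃ r : ℝ, ∃ α β : Fin K → ℝ, 0 ≤ r ∧ (∀ i, 0 ≤ α i) ∧ (∀ i, 0 ≤ β i) ∧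
      y = Pi.single 0 r + ∑ i, (α i • uvec ω i + β i • gvec γ i) := by
  induction K with
  | zero =>
    refine ⟨y 0, 0, 0, ?_, by simp, by simp, ?_⟩
    · simpa [dotProduct] using hy 1 ⟨by simp, by simp⟩
    · ext k
      obtain rfl : k = 0 := Fin.fin_one_eq_zero k
      simp
  | succ K ih =>
    set w := ω (Fin.last K) with hw
    set c := γ (Fin.last K) with hc
    have hw0 : 0 ≤ w := hω _
    have hc0 : 0 ≤ c := hγ _
    have hwc : w * c < 1 := h1 _
    have reduce (p : ℝ) (hp : 0 ≤ p) (hwp : w ≤ p) (hcp : c * p ≤ 1) (s : ℝ)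
        (hs : s = -(p * y (Fin.last (K + 1)))) :=
      ih (fun j => ω j.castSucc) (fun j => γ j.castSucc) (fun _ => hω _) (fun _ => hγ _)
        (fun _ => h1 _) ((fun k => y k.castSucc) - Pi.single (Fin.last K) s) fun ν hν => by
          have h0 := hν.1 (Fin.last K)
          have := hy _ (snoc_mem_numRep (t := p * ν (Fin.last K)) hν (by positivity)
            (by gcongr) (by nlinarith))
          rw [dotProduct, Fin.sum_univ_castSucc] at this
          simp only [Fin.snoc_castSucc, Fin.snoc_last] at this
          rw [dotProduct_sub, dotProduct_single, hs, dotProduct]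
          linarith
    rcases le_or_gt 0 (y (Fin.last (K + 1))) with hpos | hneg
    · exact exists_cone_of_peel hpos le_rfl (by simp)
        (reduce w hw0 le_rfl (by linarith [mul_comm w c]) _ (by rw [← hw]; ring))
    · rcases hc0.eq_or_lt with hcz | hcpos
      · have hzero : (0 : Fin (K + 1) → ℝ) ∈
            numRep (fun j => ω j.castSucc) (fun j => γ j.castSucc) := by
          simp [numRep]
        have := hy _ (snoc_mem_numRep (t := 1) hzero zero_le_one (by simp) (by simp [← hc, ← hcz]))
        rw [dotProduct, Fin.sum_univ_castSucc] at this
        simp at this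
        linarith
      · exact exists_cone_of_peel (a := 0) (b := c⁻¹ * -y (Fin.last (K + 1))) le_rfl
          (by have := neg_pos.2 hneg; positivity) (by rw [← hc]; field_simp; ring)
          (reduce c⁻¹ (by positivity) (by rw [← one_div, le_div_iff₀ hcpos]; exact hwc.le)
            (by rw [mul_inv_cancel₀ hcpos.ne']) _ (by ring))

/-- For nonnegative weights with `ω_i γ_i < 1`, the dual cone
`{y : ν·y ≥ 0 for all ν ∈ V}` equals the finitely generated cone spanned by the
`2(K−1)` vectors `u^1,…,u^{K−1}, g^1,…,g^{K−1}`. -/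
theorem dual_of_numRep_eq_vcone {K : ℕ} (hK : 1 ≤ K) (ω γ : Fin K → ℝ)
    (hω : ∀ i, 0 ≤ ω i) (hγ : ∀ i, 0 ≤ γ i) (h1 : ∀ i, ω i * γ i < 1) :
    {y : Fin (K + 1) → ℝ | ∀ ν ∈ numRep ω γ, 0 ≤ ∑ k, ν k * y k}
      = {y : Fin (K + 1) → ℝ | ∃ α β : Fin K → ℝ,
          (∀ i, 0 ≤ α i) ∧ (∀ i, 0 ≤ β i) ∧
          y = ∑ i, (α i • uvec ω i + β i • gvec γ i)} := by
  ext y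
  simp only [Set.mem_ofPred_eq]
  constructor
  · intro hy
    obtain ⟨r, α, β, hr, hα, hβ, rfl⟩ := exists_cone_of_mem_dual ω γ hω hγ h1 y hy
    obtain ⟨K, rfl⟩ := Nat.exists_eq_add_of_le' hK
    have hd : 0 < 1 - ω 0 * γ 0 := sub_pos.2 (h1 0)
    set d := 1 - ω 0 * γ 0 with hd_def
    have hg := hγ 0
    have single_eq : (Pi.single 0 r : Fin (K + 2) → ℝ) =
        (r / d * γ 0) • uvec ω 0 + (r / d) • gvec γ 0 := by
      have : r = r / d * d := by field_simp
      ext k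
      simp only [uvec, gvec, Pi.single_apply, Pi.add_apply, Pi.smul_apply, Pi.sub_apply,
        smul_eq_mul, Fin.castSucc_zero]
      split_ifs <;> first | (rw [hd_def] at this ⊢; linear_combination this) | ring
    refine ⟨α + Pi.single 0 (r / d * γ 0), β + Pi.single 0 (r / d),
      fun i => add_nonneg (hα i) ?_, fun i => add_nonneg (hβ i) ?_, ?_⟩
    · exact (Pi.single_nonneg.2 (by positivity) : (0 : Fin (K + 1) → ℝ) ≤ _) i
    · exact (Pi.single_nonneg.2 (by positivity) : (0 : Fin (K + 1) → ℝ) ≤ _) i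
    · rw [single_eq]
      simp only [Fin.sum_univ_succ, Pi.add_apply, Pi.single_eq_same,
        Pi.single_eq_of_ne (Fin.succ_ne_zero _), add_zero, add_smul _ _ (uvec ω 0),
        add_smul _ _ (gvec γ 0)]
      abel
  · rintro ⟨α, β, hα, hβ, rfl⟩ ν hν
    change 0 ≤ ν ⬝ᵥ _
    rw [dotProduct_sum]
    refine Finset.sum_nonneg fun i _ => ?_
    rw [dotProduct_add, dotProduct_smul, dotProduct_smul, dotProduct_uvec, dotProduct_gvec]
    exact add_nonneg (mul_nonneg (hα i) (sub_nonneg.2 (hν.2 i).1))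
      (mul_nonneg (hβ i) (sub_nonneg.2 (hν.2 i).2))
end

section
/- Let ω, γ ∈ ℝ^{K−1} have nonnegative components and satisfy ω_i γ_i < 1 for all i = 1,…,K−1. Then the finitely generated cone C = {Σ_{i=1}^{K−1} (α_i u^i + β_i g^i) : α_i ≥ 0, β_i ≥ 0} is pointed: if c ∈ C and −c ∈ C, then c = 0. -/
/-- If `a, b ≥ 0` and `a * b < 1`, some `r > 0` satisfies `a < r` and `b * r < 1`. -/
theorem exists_pos_between_of_mul_lt_one {a b : ℝ} (ha : 0 ≤ a) (hb : 0 ≤ b) (h : a * b < 1) :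
    ∃ r : ℝ, 0 < r ∧ a < r ∧ b * r < 1 := by
  have hε : 0 < (1 - a * b) / (1 + b) := div_pos (by linarith) (by linarith)
  have hmul : (1 - a * b) / (1 + b) * (1 + b) = 1 - a * b := div_mul_cancel₀ _ (by linarith)
  exact ⟨a + (1 - a * b) / (1 + b), by linarith, by linarith, by linarith⟩

/-- Some linear functional is strictly positive on all the generators `uvec ω i`, `gvec γ i`. -/
theorem exists_linearMap_pos_uvec_gvec {K : ℕ} (ω γ : Fin K → ℝ)
    (hω : ∀ i, 0 ≤ ω i) (hγ : ∀ i, 0 ≤ γ i) (h1 : ∀ i, ω i * γ i < 1) :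
    ∃ φ : (Fin (K + 1) → ℝ) →ₗ[ℝ] ℝ, (∀ i, 0 < φ (uvec ω i)) ∧ ∀ i, 0 < φ (gvec γ i) := by
  choose r hr hωr hγr using fun i => exists_pos_between_of_mul_lt_one (hω i) (hγ i) (h1 i)
  let p : Fin (K + 1) → ℝ := fun k => Fin.induction (motive := fun _ => ℝ) 1 (fun i x => r i * x) k
  have hp_succ (i : Fin K) : p i.succ = r i * p i.castSucc := Fin.induction_succ ..
  have hp (k : Fin (K + 1)) : 0 < p k := by
    induction k using Fin.induction with
    | zero => exact one_pos
    | succ i ih => rw [hp_succ]; exact mul_pos (hr i) ih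
  refine ⟨Fintype.linearCombination ℝ p, fun i => ?_, fun i => ?_⟩
  · simp only [uvec, map_sub, map_smul, Fintype.linearCombination_apply_single, smul_eq_mul,
      one_mul, hp_succ]
    nlinarith [mul_pos (sub_pos.2 (hωr i)) (hp i.castSucc)]
  · simp only [gvec, map_sub, map_smul, Fintype.linearCombination_apply_single, smul_eq_mul,
      one_mul, hp_succ]
    nlinarith [mul_pos (sub_pos.2 (hγr i)) (hp i.castSucc)]

/-- A nonnegative combination of vectors on which `φ` is positive has `φ ≥ 0`, and vanishes if
`φ ≤ 0` there. -/
theorem nonneg_and_eq_zero_of_sum_pos {ι E : Type*} [Fintype ι] [AddCommGroup E] [Module ℝ E]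
    (φ : E →ₗ[ℝ] ℝ) {u g : ι → E} (hu : ∀ i, 0 < φ (u i)) (hg : ∀ i, 0 < φ (g i))
    {α β : ι → ℝ} (hα : ∀ i, 0 ≤ α i) (hβ : ∀ i, 0 ≤ β i) :
    0 ≤ φ (∑ i, (α i • u i + β i • g i)) ∧
      (φ (∑ i, (α i • u i + β i • g i)) ≤ 0 → ∑ i, (α i • u i + β i • g i) = 0) := by
  have hαu (i : ι) : 0 ≤ α i * φ (u i) := mul_nonneg (hα i) (hu i).le
  have hβg (i : ι) : 0 ≤ β i * φ (g i) := mul_nonneg (hβ i) (hg i).le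
  have hterm : ∀ i ∈ Finset.univ, 0 ≤ α i * φ (u i) + β i * φ (g i) :=
    fun i _ => add_nonneg (hαu i) (hβg i)
  simp only [map_sum, map_add, map_smul, smul_eq_mul]
  refine ⟨Finset.sum_nonneg hterm, fun hle => Finset.sum_eq_zero fun i hi => ?_⟩
  have h0 := (Finset.sum_eq_zero_iff_of_nonneg hterm).1
    (hle.antisymm (Finset.sum_nonneg hterm)) i hi
  obtain ⟨h, h'⟩ := (add_eq_zero_iff_of_nonneg (hαu i) (hβg i)).1 h0
  rw [(mul_eq_zero_iff_right (hu i).ne').1 h, (mul_eq_zero_iff_right (hg i).ne').1 h']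
  simp

/-- For nonnegative weights with `ω_i γ_i < 1`, the finitely generated cone
`C = {Σ_i (α_i u^i + β_i g^i) : α, β ≥ 0}` is pointed: `c ∈ C` and `−c ∈ C` imply `c = 0`. -/
theorem weighted_ordinal_cone_pointed {K : ℕ} (hK : 1 ≤ K) (ω γ : Fin K → ℝ)
    (hω : ∀ i, 0 ≤ ω i) (hγ : ∀ i, 0 ≤ γ i) (h1 : ∀ i, ω i * γ i < 1) :
    ∀ c ∈ {y : Fin (K + 1) → ℝ | ∃ α β : Fin K → ℝ,
        (∀ i, 0 ≤ α i) ∧ (∀ i, 0 ≤ β i) ∧ y = ∑ i, (α i • uvec ω i + β i • gvec γ i)},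
      -c ∈ {y : Fin (K + 1) → ℝ | ∃ α β : Fin K → ℝ,
        (∀ i, 0 ≤ α i) ∧ (∀ i, 0 ≤ β i) ∧ y = ∑ i, (α i • uvec ω i + β i • gvec γ i)} →
      c = 0 := by
  rintro c ⟨α, β, hα, hβ, hc⟩ ⟨α', β', hα', hβ', hc'⟩
  obtain ⟨φ, hu, hg⟩ := exists_linearMap_pos_uvec_gvec ω γ hω hγ h1
  have h := nonneg_and_eq_zero_of_sum_pos φ hu hg hα hβ
  have h' := (nonneg_and_eq_zero_of_sum_pos φ hu hg hα' hβ').1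
  rw [← hc] at h
  rw [← hc', map_neg] at h'
  exact h.2 (neg_nonneg.1 h')
end

section
/- Let ω, γ ∈ ℝ^{K−1} have nonnegative components and satisfy ω_i γ_i < 1 for all i = 1,…,K−1. Then the K×K matrix M with entries M_{ij} = ∏_{ℓ=j}^{i−1} γ_ℓ if i > j, M_{ij} = 1 if i = j, and M_{ij} = ∏_{ℓ=i}^{j−1} ω_ℓ if i < j, is invertible. -/
/- The number of ordered categories is `K + 1` (paper's `K` is our `K + 1`); weight
vectors `ω, γ` live in `ℝ^K`.  The product `∏_{ℓ=j}^{i−1}` is encoded by a product over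
all `ℓ : Fin K` of factors that are `1` outside the range (empty products are `1`). -/

/-- The `(K+1)×(K+1)` matrix `M` with `M_{ij} = ∏_{ℓ=j}^{i−1} γ_ℓ` for `i > j`,
`M_{ii} = 1`, and `M_{ij} = ∏_{ℓ=i}^{j−1} ω_ℓ` for `i < j`. -/
def mMat {K : ℕ} (ω γ : Fin K → ℝ) : Matrix (Fin (K + 1)) (Fin (K + 1)) ℝ :=
  Matrix.of fun i j =>
    if (j : ℕ) < (i : ℕ) then
      ∏ ℓ : Fin K, (if (j : ℕ) ≤ (ℓ : ℕ) ∧ (ℓ : ℕ) < (i : ℕ) then γ ℓ else 1)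
    else if (i : ℕ) < (j : ℕ) then
      ∏ ℓ : Fin K, (if (i : ℕ) ≤ (ℓ : ℕ) ∧ (ℓ : ℕ) < (j : ℕ) then ω ℓ else 1)
    else 1

theorem prod_Ico_succ_right {K : ℕ} (w : Fin K → ℝ) (a : ℕ) (j : Fin K) (h : a ≤ j) :
    (∏ ℓ : Fin K, if a ≤ (ℓ : ℕ) ∧ (ℓ : ℕ) < (j : ℕ) + 1 then w ℓ else 1) =
      w j * ∏ ℓ : Fin K, if a ≤ (ℓ : ℕ) ∧ (ℓ : ℕ) < (j : ℕ) then w ℓ else 1 := by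
  have e : w j = ∏ ℓ : Fin K, if ℓ = j then w ℓ else 1 := by simp
  rw [e, ← Finset.prod_mul_distrib]
  refine Finset.prod_congr rfl fun ℓ _ => ?_
  split_ifs <;> first | (simp; done) | (exfalso; simp only [Fin.ext_iff] at *; omega)

theorem prod_Ico_eq_mul_prod_Ico_succ {K : ℕ} (w : Fin K → ℝ) (b : ℕ) (j : Fin K)
    (h : (j : ℕ) < b) :
    (∏ ℓ : Fin K, if (j : ℕ) ≤ (ℓ : ℕ) ∧ (ℓ : ℕ) < b then w ℓ else 1) =
      w j * ∏ ℓ : Fin K, if (j : ℕ) + 1 ≤ (ℓ : ℕ) ∧ (ℓ : ℕ) < b then w ℓ else 1 := by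
  have e : w j = ∏ ℓ : Fin K, if ℓ = j then w ℓ else 1 := by simp
  rw [e, ← Finset.prod_mul_distrib]
  refine Finset.prod_congr rfl fun ℓ _ => ?_
  split_ifs <;> first | (simp; done) | (exfalso; simp only [Fin.ext_iff] at *; omega)

theorem prod_Ico_self {K : ℕ} (w : Fin K → ℝ) (a : ℕ) :
    (∏ ℓ : Fin K, if a ≤ (ℓ : ℕ) ∧ (ℓ : ℕ) < a then w ℓ else 1) = 1 :=
  Finset.prod_eq_one fun ℓ _ => if_neg (by omega)

theorem mMat_apply_of_le {K : ℕ} (ω γ : Fin K → ℝ) {i j : Fin (K + 1)} (h : i ≤ j) :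
    mMat ω γ i j =
      ∏ ℓ : Fin K, if (i : ℕ) ≤ (ℓ : ℕ) ∧ (ℓ : ℕ) < (j : ℕ) then ω ℓ else 1 := by
  rcases h.eq_or_lt with rfl | h
  · simp [mMat, prod_Ico_self]
  · have h' : (i : ℕ) < j := h
    simp only [mMat, Matrix.of_apply, if_neg h'.not_gt, if_pos h']

theorem mMat_apply_of_ge {K : ℕ} (ω γ : Fin K → ℝ) {i j : Fin (K + 1)} (h : j ≤ i) :
    mMat ω γ i j =
      ∏ ℓ : Fin K, if (j : ℕ) ≤ (ℓ : ℕ) ∧ (ℓ : ℕ) < (i : ℕ) then γ ℓ else 1 := by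
  rcases h.eq_or_lt with rfl | h
  · simp [mMat, prod_Ico_self]
  · have h' : (j : ℕ) < i := h
    simp only [mMat, Matrix.of_apply, if_pos h']

theorem mMat_self {K : ℕ} (ω γ : Fin K → ℝ) (i : Fin (K + 1)) : mMat ω γ i i = 1 := by
  simp [mMat]

theorem mMat_succ_right {K : ℕ} (ω γ : Fin K → ℝ) {i : Fin (K + 1)} {j : Fin K}
    (h : i ≤ j.castSucc) : mMat ω γ i j.succ = ω j * mMat ω γ i j.castSucc := by
  rw [mMat_apply_of_le ω γ h, mMat_apply_of_le ω γ (h.trans j.castSucc_lt_succ.le)]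
  simpa using prod_Ico_succ_right ω i j h

theorem mMat_castSucc_right {K : ℕ} (ω γ : Fin K → ℝ) {i : Fin (K + 1)} {j : Fin K}
    (h : j.succ ≤ i) : mMat ω γ i j.castSucc = γ j * mMat ω γ i j.succ := by
  rw [mMat_apply_of_ge ω γ h, mMat_apply_of_ge ω γ (j.castSucc_lt_succ.le.trans h)]
  simpa using prod_Ico_eq_mul_prod_Ico_succ γ i j h

/-- Subtracting `ω_j` times column `j` from column `j + 1` makes `mMat ω γ` lower triangular. -/
theorem det_mMat {K : ℕ} (ω γ : Fin K → ℝ) :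
    (mMat ω γ).det = ∏ i, (1 - ω i * γ i) := by
  let B : Matrix (Fin (K + 1)) (Fin (K + 1)) ℝ := Matrix.of fun i j =>
    Fin.cases (mMat ω γ i 0) (fun j => mMat ω γ i j.succ - ω j * mMat ω γ i j.castSucc) j
  have hB : (mMat ω γ).det = B.det :=
    Matrix.det_eq_of_forall_col_eq_smul_add_pred ω (fun i => rfl) fun i j => by simp [B]
  have hT : B.IsLowerTriangular := by
    intro i j hij
    replace hij : i < j := hij
    induction j using Fin.cases with
    | zero => exact absurd hij (Fin.not_lt_zero i)
    | succ j =>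
      simp [B, mMat_succ_right ω γ (Fin.le_castSucc_iff.mpr hij)]
  rw [hB, Matrix.det_of_isLowerTriangular B hT, Fin.prod_univ_succ]
  simp [B, mMat_self, mMat_castSucc_right]

/-- For nonnegative weights with `ω_i γ_i < 1`, the matrix `M` is invertible. -/
theorem mMat_invertible {K : ℕ} (hK : 1 ≤ K) (ω γ : Fin K → ℝ)
    (hω : ∀ i, 0 ≤ ω i) (hγ : ∀ i, 0 ≤ γ i) (h1 : ∀ i, ω i * γ i < 1) :
    IsUnit (mMat ω γ).det := by
  rw [det_mMat, isUnit_iff_ne_zero]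
  exact Finset.prod_ne_zero_iff.mpr fun i _ => (sub_pos.mpr (h1 i)).ne'
end

section
/- Let ω, γ ∈ ℝ^{K−1} have nonnegative components and satisfy ω_i γ_i < 1 for all i = 1,…,K−1. If y¹, y² ∈ ℝ^K satisfy ν·y¹ ≤ ν·y² and ν·y² ≤ ν·y¹ for every ν ∈ V, then y¹ = y²; that is, the relation u ≼ v ⟺ (ν·u ≤ ν·v for all ν ∈ V) is antisymmetric. -/
open Filter Topology in
/-- A vector satisfying all the defining inequalities strictly is interior to `numRep ω γ`. -/
lemma numRep_mem_nhds {K : ℕ} {ω γ : Fin K → ℝ} {ν : Fin (K + 1) → ℝ} (hpos : ∀ k, 0 < ν k)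
    (hων : ∀ i, ω i * ν (Fin.castSucc i) < ν i.succ)
    (hγν : ∀ i, γ i * ν i.succ < ν (Fin.castSucc i)) :
    numRep ω γ ∈ 𝓝 ν := by
  have e0 : ∀ᶠ μ in 𝓝 ν, ∀ k, 0 < μ k := eventually_all.2 fun k =>
    (continuous_apply k).continuousAt.eventually_const_lt (hpos k)
  have e1 : ∀ᶠ μ in 𝓝 ν, ∀ i : Fin K, ω i * μ i.castSucc < μ i.succ := eventually_all.2 fun i =>
    (isOpen_lt (by fun_prop) (by fun_prop)).mem_nhds (hων i)
  have e2 : ∀ᶠ μ in 𝓝 ν, ∀ i : Fin K, γ i * μ i.succ < μ i.castSucc := eventually_all.2 fun i =>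
    (isOpen_lt (by fun_prop) (by fun_prop)).mem_nhds (hγν i)
  filter_upwards [e0, e1, e2] with μ h0 h1 h2
  exact ⟨fun k => (h0 k).le, fun i => ⟨(h1 i).le, (h2 i).le⟩⟩

lemma exists_strict_numRep {K : ℕ} {ω γ : Fin K → ℝ}
    (hω : ∀ i, 0 ≤ ω i) (hγ : ∀ i, 0 ≤ γ i) (h1 : ∀ i, ω i * γ i < 1) :
    ∃ ν : Fin (K + 1) → ℝ, (∀ k, 0 < ν k) ∧ (∀ i, ω i * ν (Fin.castSucc i) < ν i.succ) ∧
      ∀ i, γ i * ν i.succ < ν (Fin.castSucc i) := by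
  have ratio : ∀ i, ∃ t, ω i < t ∧ γ i * t < 1 := fun i => by
    have hγ' : 0 < 1 + γ i := by linarith [hγ i]
    refine ⟨ω i + (1 - ω i * γ i) / (1 + γ i),
      lt_add_of_pos_right _ (div_pos (by linarith [h1 i]) hγ'), ?_⟩
    rw [add_div' _ _ _ hγ'.ne', mul_div_assoc', div_lt_one hγ']
    nlinarith [h1 i]
  choose t hωt hγt using ratio
  let ν : Fin (K + 1) → ℝ := fun k => Fin.induction (motive := fun _ => ℝ) 1 (fun i x => t i * x) k
  have succ_eq : ∀ i : Fin K, ν i.succ = t i * ν i.castSucc := fun i => Fin.induction_succ ..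
  have pos : ∀ k, 0 < ν k := by
    intro k
    induction k using Fin.induction with
    | zero => exact one_pos
    | succ i ih =>
      rw [succ_eq]
      exact mul_pos ((hω i).trans_lt (hωt i)) ih
  refine ⟨ν, pos, fun i => ?_, fun i => ?_⟩
  · rw [succ_eq]
    exact mul_lt_mul_of_pos_right (hωt i) (pos _)
  · rw [succ_eq, ← mul_assoc]
    exact mul_lt_of_lt_one_left (pos _) (hγt i)

open Filter Topology in
/-- Vectors with equal pairings against a neighbourhood of a point are equal. -/
lemma eq_of_sum_mul_eq_of_mem_nhds {ι : Type*} [Fintype ι] {s : Set (ι → ℝ)} {x y z : ι → ℝ}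
    (hs : s ∈ 𝓝 x) (h : ∀ ν ∈ s, ∑ k, ν k * y k = ∑ k, ν k * z k) : y = z := by
  classical
  ext k
  have lim : Tendsto (fun ε : ℝ => x + ε • Pi.single k (1 : ℝ)) (𝓝[>] 0) (𝓝 x) := by
    have hc : Continuous fun ε : ℝ => x + ε • (Pi.single k 1 : ι → ℝ) := by fun_prop
    simpa using (hc.tendsto 0).mono_left nhdsWithin_le_nhds
  obtain ⟨ε, hεs, hε⟩ := ((lim.eventually hs).and self_mem_nhdsWithin).exists
  have hx := h x (mem_of_mem_nhds hs)
  have hxε := h _ hεs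
  simp only [Pi.add_apply, Pi.smul_apply, smul_eq_mul, add_mul, Finset.sum_add_distrib, hx,
    add_right_inj, Pi.single_apply, mul_ite, mul_one, mul_zero, ite_mul, zero_mul,
    Finset.sum_ite_eq', Finset.mem_univ, if_true] at hxε
  exact mul_left_cancel₀ (ne_of_gt hε) hxε

/-- For nonnegative weights with `ω_i γ_i < 1`, the relation
`u ≼ v ⟺ (ν·u ≤ ν·v for all ν ∈ V)` is antisymmetric: if `ν·y¹ ≤ ν·y²` and
`ν·y² ≤ ν·y¹` for every `ν ∈ V`, then `y¹ = y²`. -/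
theorem precRel_antisymm {K : ℕ} (hK : 1 ≤ K) (ω γ : Fin K → ℝ)
    (hω : ∀ i, 0 ≤ ω i) (hγ : ∀ i, 0 ≤ γ i) (h1 : ∀ i, ω i * γ i < 1)
    (y₁ y₂ : Fin (K + 1) → ℝ)
    (h12 : ∀ ν ∈ numRep ω γ, ∑ k, ν k * y₁ k ≤ ∑ k, ν k * y₂ k)
    (h21 : ∀ ν ∈ numRep ω γ, ∑ k, ν k * y₂ k ≤ ∑ k, ν k * y₁ k) :
    y₁ = y₂ := by
  obtain ⟨ν, hpos, hων, hγν⟩ := exists_strict_numRep hω hγ h1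
  exact eq_of_sum_mul_eq_of_mem_nhds (numRep_mem_nhds hpos hων hγν)
    fun μ hμ => (h12 μ hμ).antisymm (h21 μ hμ)
end

section
/- Let ω, γ ∈ ℝ^{K−1} satisfy ω_i > 0, γ_i > 0 and ω_i γ_i < 1 for all i = 1,…,K−1. Let n ∈ ℝ^K with n ≠ 0, and suppose there is an index i ∈ {1,…,K−1} with n·u^i = 0 and n·g^i = 0. Then there exists an index j ∈ {1,…,K−1} such that (n·u^j)·(n·g^j) < 0; in particular, the hyperplane with normal vector n is not a supporting hyperplane of the cone generated by u^1,…,u^{K−1}, g^1,…,g^{K−1}. -/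
theorem sum_mul_uvec {K : ℕ} (ω : Fin K → ℝ) (n : Fin (K + 1) → ℝ) (j : Fin K) :
    ∑ k, n k * uvec ω j k = n j.succ - ω j * n j.castSucc := by
  simp [uvec, Pi.single_apply, mul_sub, Finset.sum_sub_distrib, mul_comm]

theorem sum_mul_gvec {K : ℕ} (γ : Fin K → ℝ) (n : Fin (K + 1) → ℝ) (j : Fin K) :
    ∑ k, n k * gvec γ j k = n j.castSucc - γ j * n j.succ := by
  simp [gvec, Pi.single_apply, mul_sub, Finset.sum_sub_distrib, mul_comm]

/-- If consecutive values of `n` vanish simultaneously, all values vanish simultaneously. -/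
theorem Fin.eq_zero_iff_of_castSucc_iff_succ {K : ℕ} {n : Fin (K + 1) → ℝ}
    (h : ∀ j : Fin K, n j.castSucc = 0 ↔ n j.succ = 0) (k : Fin (K + 1)) :
    n k = 0 ↔ n 0 = 0 := by
  induction k using Fin.induction with
  | zero => rfl
  | succ j ih => rw [← h j, ih]

/-- Let the weights be strictly positive with `ω_i γ_i < 1`.  If `n ≠ 0` is orthogonal to
both `u^i` and `g^i` for some `i`, then there is an index `j` with
`(n·u^j)·(n·g^j) < 0`; in particular, the hyperplane with normal vector `n` is not a
supporting hyperplane of the cone generated by the `u^i` and `g^i`. -/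
theorem no_facet_through_both_rays {K : ℕ} (hK : 1 ≤ K) (ω γ : Fin K → ℝ)
    (hω : ∀ i, 0 < ω i) (hγ : ∀ i, 0 < γ i) (h1 : ∀ i, ω i * γ i < 1)
    (n : Fin (K + 1) → ℝ) (hn : n ≠ 0) (i : Fin K)
    (hu : ∑ k, n k * uvec ω i k = 0) (hg : ∑ k, n k * gvec γ i k = 0) :
    ∃ j : Fin K, (∑ k, n k * uvec ω j k) * (∑ k, n k * gvec γ j k) < 0 := by
  simp only [sum_mul_uvec, sum_mul_gvec] at hu hg ⊢
  by_contra! hneg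
  have hstep (j : Fin K) : n j.castSucc = 0 ↔ n j.succ = 0 := by
    have hj := hneg j
    constructor <;> intro h0 <;> rw [h0] at hj <;> by_contra hne
    · nlinarith [mul_pos (hγ j) (sq_pos_of_ne_zero hne)]
    · nlinarith [mul_pos (hω j) (sq_pos_of_ne_zero hne)]
  have hi : n i.castSucc = 0 := by
    have hprod : (1 - ω i * γ i) * n i.castSucc = 0 := by
      linear_combination hg + γ i * hu
    exact (mul_eq_zero.mp hprod).resolve_left (sub_pos.mpr (h1 i)).ne'
  have hall := Fin.eq_zero_iff_of_castSucc_iff_succ hstep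
  exact hn (funext fun k => (hall k).mpr ((hall _).mp hi))
end

section
/- Let ω, γ ∈ ℝ^{K−1} and let r^1, …, r^{K−1} be any choice of vectors with r^i ∈ {u^i, g^i} for each i = 1,…,K−1. Define n ∈ ℝ^K by n_k = ∏_{i=1}^{K−1} d^i_k, where d^i_k = ω_i if r^i = u^i and k > i; d^i_k = 1 if r^i = u^i and k ≤ i; d^i_k = γ_i if r^i = g^i and k ≤ i; and d^i_k = 1 if r^i = g^i and k > i. Then n·r^i = 0 for every i = 1,…,K−1. -/
/-- The ray `r^i` chosen by the selector `s`. -/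
def rvec {K : ℕ} (ω γ : Fin K → ℝ) (s : Fin K → Bool) (i : Fin K) : Fin (K + 1) → ℝ :=
  if s i then uvec ω i else gvec γ i

/-- The factor `d^i_k`: `ω_i` if `r^i = u^i` and `k > i`; `1` if `r^i = u^i` and `k ≤ i`;
`γ_i` if `r^i = g^i` and `k ≤ i`; `1` if `r^i = g^i` and `k > i`. -/
def dfac {K : ℕ} (ω γ : Fin K → ℝ) (s : Fin K → Bool) (i : Fin K) (k : Fin (K + 1)) : ℝ :=
  if s i then (if (i : ℕ) < (k : ℕ) then ω i else 1)
  else (if (k : ℕ) ≤ (i : ℕ) then γ i else 1)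

/-- The normal vector `n` with `n_k = ∏_i d^i_k`. -/
def nvec {K : ℕ} (ω γ : Fin K → ℝ) (s : Fin K → Bool) (k : Fin (K + 1)) : ℝ :=
  ∏ i : Fin K, dfac ω γ s i k

/-- The factor `d^j` takes the same value at the two categories adjacent to weight `i ≠ j`. -/
lemma dfac_succ_eq_castSucc {K : ℕ} (ω γ : Fin K → ℝ) (s : Fin K → Bool) {i j : Fin K}
    (h : j ≠ i) : dfac ω γ s j i.succ = dfac ω γ s j i.castSucc := by
  have hne : (j : ℕ) ≠ i := Fin.val_ne_of_ne h
  have hlt : (j : ℕ) < (i : ℕ) + 1 ↔ (j : ℕ) < i := by omega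
  have hle : (i : ℕ) + 1 ≤ (j : ℕ) ↔ (i : ℕ) ≤ j := by omega
  simp only [dfac, Fin.val_succ, Fin.val_castSucc, hlt, hle]

/-- Adjacent entries of `n` share all factors except the one indexed by the weight between them. -/
lemma exists_nvec_eq_dfac_mul {K : ℕ} (ω γ : Fin K → ℝ) (s : Fin K → Bool) (i : Fin K) :
    ∃ c : ℝ, nvec ω γ s i.succ = dfac ω γ s i i.succ * c ∧
      nvec ω γ s i.castSucc = dfac ω γ s i i.castSucc * c := by
  refine ⟨∏ j ∈ Finset.univ.erase i, dfac ω γ s j i.castSucc, ?_, ?_⟩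
  · rw [nvec, ← Finset.mul_prod_erase _ _ (Finset.mem_univ i)]
    congr 1
    exact Finset.prod_congr rfl fun j hj =>
      dfac_succ_eq_castSucc ω γ s (Finset.ne_of_mem_erase hj)
  · exact (Finset.mul_prod_erase Finset.univ (fun j => dfac ω γ s j i.castSucc)
      (Finset.mem_univ i)).symm

/-- For any choice `r^i ∈ {u^i, g^i}`, the vector `n` defined via the factors `d^i_k`
is orthogonal to every chosen ray: `n·r^i = 0` for all `i`. -/
theorem nvec_orthogonal_to_chosen_rays {K : ℕ} (hK : 1 ≤ K) (ω γ : Fin K → ℝ)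
    (s : Fin K → Bool) :
    ∀ i : Fin K, ∑ k, nvec ω γ s k * rvec ω γ s i k = 0 := by
  intro i
  obtain ⟨c, h_succ, h_cast⟩ := exists_nvec_eq_dfac_mul ω γ s i
  cases hs : s i <;>
    simp [rvec, uvec, gvec, hs, mul_sub, Finset.sum_sub_distrib, Pi.single_apply, h_succ, h_cast,
      dfac] <;>
    ring
end

section
/- Let ω ∈ ℝ^{K−1} satisfy ω_i > 0 for all i, and set γ_i = 1/ω_i for all i = 1,…,K−1. Define n ∈ ℝ^K by n_k = ∏_{ℓ=1}^{k−1} ω_ℓ (so n_1 = 1). Then V = {t·n : t ≥ 0}, and consequently the induced cone {y ∈ ℝ^K : ν·y ≥ 0 for all ν ∈ V} is the closed halfspace {y ∈ ℝ^K : Σ_{k=1}^{K} (∏_{ℓ=1}^{k−1} ω_ℓ) y_k ≥ 0}. -/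
/-- The vector `n` with `n_k = ∏_{ℓ=1}^{k−1} ω_ℓ` (so `n_1 = 1`). -/
def nprod {K : ℕ} (ω : Fin K → ℝ) (k : Fin (K + 1)) : ℝ :=
  ∏ ℓ : Fin K, if (ℓ : ℕ) < (k : ℕ) then ω ℓ else 1

theorem nprod_zero {K : ℕ} (ω : Fin K → ℝ) : nprod ω 0 = 1 := by
  simp [nprod]

theorem nprod_succ {K : ℕ} (ω : Fin K → ℝ) (i : Fin K) :
    nprod ω i.succ = ω i * nprod ω i.castSucc := by
  have h : ∀ ℓ : Fin K, (if (ℓ : ℕ) < (i.succ : ℕ) then ω ℓ else 1) =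
      (if ℓ = i then ω ℓ else 1) * (if (ℓ : ℕ) < (i.castSucc : ℕ) then ω ℓ else 1) := by
    intro ℓ
    rcases lt_trichotomy ℓ i with hlt | rfl | hgt
    · have : (ℓ : ℕ) < i := hlt
      simp [hlt.ne, this, this.trans (Nat.lt_succ_self _)]
    · simp
    · have : (i : ℕ) < ℓ := hgt
      simp [hgt.ne', hgt.not_ge, this.not_gt]
  simp only [nprod, h, Finset.prod_mul_distrib, Finset.prod_ite_eq', Finset.mem_univ, if_true]

theorem nprod_nonneg {K : ℕ} {ω : Fin K → ℝ} (hω : ∀ i, 0 ≤ ω i) (k : Fin (K + 1)) :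
    0 ≤ nprod ω k := by
  refine Finset.prod_nonneg fun ℓ _ => ?_
  split_ifs
  exacts [hω ℓ, zero_le_one]

theorem numRep_inv_eq_ray {K : ℕ} {ω : Fin K → ℝ} (hω : ∀ i, 0 < ω i) :
    numRep ω (fun i => (ω i)⁻¹) =
      {x : Fin (K + 1) → ℝ | ∃ t : ℝ, 0 ≤ t ∧ x = t • nprod ω} := by
  ext ν
  constructor
  · rintro ⟨hν, hi⟩
    refine ⟨ν 0, hν 0, funext fun k => ?_⟩
    rw [Pi.smul_apply, smul_eq_mul]
    induction k using Fin.induction with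
    | zero => rw [nprod_zero, mul_one]
    | succ i ih =>
      have h : ν i.succ = ω i * ν i.castSucc :=
        le_antisymm ((inv_mul_le_iff₀ (hω i)).1 (hi i).2) (hi i).1
      rw [h, ih, nprod_succ]
      ring
  · rintro ⟨t, ht, rfl⟩
    refine ⟨fun k => mul_nonneg ht (nprod_nonneg (fun i => (hω i).le) k), fun i => ?_⟩
    have h : (t • nprod ω) i.succ = ω i * (t • nprod ω) i.castSucc := by
      simp only [Pi.smul_apply, smul_eq_mul, nprod_succ]
      ring
    exact ⟨h.ge, (inv_mul_le_iff₀ (hω i)).2 h.le⟩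

/-- For `ω > 0` and `γ_i = 1/ω_i`, the set `V` is the ray `{t·n : t ≥ 0}` spanned by
`n_k = ∏_{ℓ=1}^{k−1} ω_ℓ`, and consequently the induced cone
`{y : ν·y ≥ 0 for all ν ∈ V}` is the closed halfspace `{y : n·y ≥ 0}`. -/
theorem numRep_eq_ray_and_cone_eq_halfspace {K : ℕ} (hK : 1 ≤ K) (ω : Fin K → ℝ)
    (hω : ∀ i, 0 < ω i) :
    numRep ω (fun i => (ω i)⁻¹) = {x : Fin (K + 1) → ℝ | ∃ t : ℝ, 0 ≤ t ∧ x = t • nprod ω} ∧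
    {y : Fin (K + 1) → ℝ | ∀ ν ∈ numRep ω (fun i => (ω i)⁻¹), 0 ≤ ∑ k, ν k * y k}
      = {y : Fin (K + 1) → ℝ | 0 ≤ ∑ k, nprod ω k * y k} := by
  refine ⟨numRep_inv_eq_ray hω, ?_⟩
  rw [numRep_inv_eq_ray hω]
  ext y
  constructor
  · exact fun hy => hy _ ⟨1, zero_le_one, (one_smul ℝ _).symm⟩
  · rintro hy _ ⟨t, ht, rfl⟩
    simp only [Pi.smul_apply, smul_eq_mul, mul_assoc, ← Finset.mul_sum]
    exact mul_nonneg ht hy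
end
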